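/- arXiv:2011.06834 — 2 statements merged into one kernel-verified Lean document; each statement's English description precedes it below -/
import Mathlib

section
/- Let 1 < q < ∞ and q* = q/(q−1). Then for all x ∈ [0, π_{q*,q}/4) (equivalently x ∈ [0, π_{2,q}/2^{2/q+1})), cos_{2,q}(2^{2/q} x) = (cos_{q*,q}(x))^{q*} − (sin_{q*,q}(x))^q. -/
open MeasureTheory Set
open scoped ENNReal

/-- `genF p q y = ∫_0^y (1 - t^q)^(-1/p) dt`, whose inverse is the generalized sine. -/
noncomputable def genF (p q y : ℝ) : ℝ := ∫ t in (0:ℝ)..y, (1 - t ^ q) ^ (-(1 / p))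

/-- `genG p q y = ∫_0^y (1 + t^q)^(-1/p) dt`, whose inverse is the generalized hyperbolic sine. -/
noncomputable def genG (p q y : ℝ) : ℝ := ∫ t in (0:ℝ)..y, (1 + t ^ q) ^ (-(1 / p))

/-- The generalized π, `π_{p,q} = 2∫_0^1 (1 - t^q)^(-1/p) dt`, as an extended real number
(it is `∞` when `q/(q+1) < p ≤ 1`). -/
noncomputable def genPi (p q : ℝ) : ℝ≥0∞ :=
  2 * ∫⁻ t in Ioo (0:ℝ) 1, ENNReal.ofReal ((1 - t ^ q) ^ (-(1 / p)))

/-- The generalized sine `sin_{p,q}`: the inverse of `genF p q`, which maps `[0,1)` onto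
`[0, π_{p,q}/2)`. -/
noncomputable def gsin (p q : ℝ) : ℝ → ℝ := Function.invFunOn (genF p q) (Ico 0 1)

/-- The generalized cosine `cos_{p,q} x = (d/dx) sin_{p,q} x` (one-sided at `x = 0`). -/
noncomputable def gcos (p q x : ℝ) : ℝ := derivWithin (gsin p q) (Ici 0) x

/-- The generalized hyperbolic sine `sinh_{p,q}`: the inverse of `genG p q`, which maps
`[0,∞)` onto `[0, π_{r,q}/2)` where `r = pq/(pq+p-q)`. -/
noncomputable def gsinh (p q : ℝ) : ℝ → ℝ := Function.invFunOn (genG p q) (Ici 0)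

/-- The generalized hyperbolic cosine `cosh_{p,q} x = (d/dx) sinh_{p,q} x`
(one-sided at `x = 0`). -/
noncomputable def gcosh (p q x : ℝ) : ℝ := derivWithin (gsinh p q) (Ici 0) x

theorem one_sub_rpow_pos {q t : ℝ} (hq : 0 < q) (ht : t ∈ Ioo (-1 : ℝ) 1) : 0 < 1 - t ^ q := by
  have h1 : |t| < 1 := abs_lt.2 ⟨ht.1, ht.2⟩
  have h2 : |t| ^ q < 1 := Real.rpow_lt_one (abs_nonneg t) h1 hq
  have h3 := (le_abs_self _).trans (Real.abs_rpow_le_abs_rpow t q)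
  linarith

theorem continuousOn_genF_integrand {q : ℝ} (p : ℝ) (hq : 0 < q) :
    ContinuousOn (fun t : ℝ => (1 - t ^ q) ^ (-(1 / p))) (Ioo (-1) 1) := by
  apply ContinuousOn.rpow_const
  · exact (continuous_const.sub (Real.continuous_rpow_const hq.le)).continuousOn
  · exact fun t ht => Or.inl (one_sub_rpow_pos hq ht).ne'

theorem hasStrictDerivAt_genF {q y : ℝ} (p : ℝ) (hq : 0 < q) (hy : y ∈ Ioo (-1 : ℝ) 1) :
    HasStrictDerivAt (genF p q) ((1 - y ^ q) ^ (-(1 / p))) y := by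
  have hc := continuousOn_genF_integrand p hq
  refine intervalIntegral.integral_hasStrictDerivAt_right ?_
    (hc.stronglyMeasurableAtFilter isOpen_Ioo y hy) (hc.continuousAt (isOpen_Ioo.mem_nhds hy))
  exact (hc.mono (ordConnected_Ioo.uIcc_subset (by simp) hy)).intervalIntegrable

theorem strictMonoOn_genF {q : ℝ} (p : ℝ) (hq : 0 < q) :
    StrictMonoOn (genF p q) (Ioo (-1) 1) := by
  refine strictMonoOn_of_deriv_pos (convex_Ioo _ _)
    (fun y hy => (hasStrictDerivAt_genF p hq hy).hasDerivAt.continuousAt.continuousWithinAt)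
    fun y hy => ?_
  rw [interior_Ioo] at hy
  rw [(hasStrictDerivAt_genF p hq hy).hasDerivAt.deriv]
  exact Real.rpow_pos_of_pos (one_sub_rpow_pos hq hy) _

theorem genF_zero (p q : ℝ) : genF p q 0 = 0 := by simp [genF]

theorem gsin_genF {q y : ℝ} (p : ℝ) (hq : 0 < q) (hy : y ∈ Ico (0 : ℝ) 1) :
    gsin p q (genF p q y) = y := by
  have h : StrictMonoOn (genF p q) (Ico 0 1) :=
    (strictMonoOn_genF p hq).mono fun t ht => ⟨by linarith [ht.1], ht.2⟩
  exact h.injOn.leftInvOn_invFunOn hy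

theorem genF_nonneg {q y : ℝ} (p : ℝ) (hq : 0 < q) (hy : y ∈ Ico (0 : ℝ) 1) :
    0 ≤ genF p q y := by
  rw [← genF_zero p q]
  exact (strictMonoOn_genF p hq).monotoneOn (by simp) ⟨by linarith [hy.1], hy.2⟩ hy.1

theorem gcos_genF {q y : ℝ} (p : ℝ) (hq : 0 < q) (hy : y ∈ Ico (0 : ℝ) 1) :
    gcos p q (genF p q y) = (1 - y ^ q) ^ (1 / p) := by
  have hy' : y ∈ Ioo (-1 : ℝ) 1 := ⟨by linarith [hy.1], hy.2⟩
  have hpos := one_sub_rpow_pos hq hy'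
  have hd := hasStrictDerivAt_genF p hq hy'
  have hne : (1 - y ^ q) ^ (-(1 / p)) ≠ 0 := (Real.rpow_pos_of_pos hpos _).ne'
  have hinv := (hd.to_localInverse hne).hasDerivAt
  have himage : hd.localInverse _ _ _ hne (genF p q y) = y :=
    HasStrictFDerivAt.localInverse_apply_image (hd.hasStrictFDerivAt_equiv hne)
  have hmem : ∀ᶠ z in nhds (genF p q y), hd.localInverse _ _ _ hne z ∈ Ioo (-1 : ℝ) 1 :=
    hinv.continuousAt.eventually (by rw [himage]; exact isOpen_Ioo.mem_nhds hy')
  have heq : gsin p q =ᶠ[nhdsWithin (genF p q y) (Ici 0)] hd.localInverse _ _ _ hne := by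
    filter_upwards [nhdsWithin_le_nhds hmem,
      nhdsWithin_le_nhds (hd.eventually_right_inverse hne), self_mem_nhdsWithin] with z h1 h2 h3
    have h4 : 0 ≤ hd.localInverse _ _ _ hne z := by
      rw [← (strictMonoOn_genF p hq).le_iff_le (by simp) h1, h2, genF_zero]
      exact h3
    conv_lhs => rw [← h2]
    exact gsin_genF p hq ⟨h4, h1.2⟩
  have hw := hinv.hasDerivWithinAt.congr_of_eventuallyEq heq
    (by rw [himage, gsin_genF p hq hy])
  rw [gcos, hw.derivWithin (uniqueDiffOn_Ici 0 _ (genF_nonneg p hq hy)), Real.rpow_neg hpos.le,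
    inv_inv]

theorem lintegral_genF_integrand {q y : ℝ} (p : ℝ) (hq : 0 < q) (hy : y ∈ Ico (0 : ℝ) 1) :
    ∫⁻ t in Ioc 0 y, ENNReal.ofReal ((1 - t ^ q) ^ (-(1 / p))) =
      ENNReal.ofReal (genF p q y) := by
  have hsub : Icc 0 y ⊆ Ioo (-1 : ℝ) 1 := fun t ht => ⟨by linarith [ht.1], ht.2.trans_lt hy.2⟩
  rw [genF, intervalIntegral.integral_of_le hy.1, ofReal_integral_eq_lintegral_ofReal]
  · exact (((continuousOn_genF_integrand p hq).mono hsub).integrableOn_Icc).mono_set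
      Ioc_subset_Icc_self
  · filter_upwards [ae_restrict_mem measurableSet_Ioc] with t ht
    exact Real.rpow_nonneg (one_sub_rpow_pos hq (hsub (Ioc_subset_Icc_self ht))).le _

theorem neg_one_div_conjExponent {q : ℝ} (hq : 1 < q) : -(1 / (q / (q - 1))) = 1 / q - 1 := by
  have : q - 1 ≠ 0 := by linarith
  field_simp
  ring

theorem hasDerivAt_one_sub_rpow_rpow {q t : ℝ} (hq : 1 < q) (ht : t ∈ Ico (0 : ℝ) 1) :
    HasDerivAt (fun t : ℝ => (1 - t ^ q) ^ (1 / q)) (-(t ^ (q - 1) * (1 - t ^ q) ^ (1 / q - 1)))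
      t := by
  have hpos := one_sub_rpow_pos (by linarith : 0 < q) (t := t) ⟨by linarith [ht.1], ht.2⟩
  have h := (((Real.hasDerivAt_rpow_const (x := t) (p := q) (Or.inr hq.le)).const_sub 1).rpow_const
    (p := 1 / q) (Or.inl hpos.ne'))
  convert h using 1
  field_simp

theorem one_sub_rpow_rpow_mem_Ioo {q t : ℝ} (hq : 0 < q) (ht : t ∈ Ioo (0 : ℝ) 1) :
    (1 - t ^ q) ^ (1 / q) ∈ Ioo (0 : ℝ) 1 := by
  have hpos := one_sub_rpow_pos hq (t := t) ⟨by linarith [ht.1], ht.2⟩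
  have := Real.rpow_pos_of_pos ht.1 q
  exact ⟨Real.rpow_pos_of_pos hpos _, Real.rpow_lt_one hpos.le (by linarith) (by positivity)⟩

theorem one_sub_rpow_rpow_involutive {q t : ℝ} (hq : 0 < q) (ht : t ∈ Ioo (0 : ℝ) 1) :
    (1 - ((1 - t ^ q) ^ (1 / q)) ^ q) ^ (1 / q) = t := by
  have hpos := one_sub_rpow_pos hq (t := t) ⟨by linarith [ht.1], ht.2⟩
  rw [← Real.rpow_mul hpos.le, one_div_mul_cancel hq.ne', Real.rpow_one, sub_sub_cancel,
    ← Real.rpow_mul ht.1.le, mul_one_div_cancel hq.ne', Real.rpow_one]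

theorem lintegral_upper_eq_lintegral_lower {q a : ℝ} (hq : 1 < q) (ha : a ∈ Ioo (0 : ℝ) 1)
    (haq : a ^ q = 1 / 2) :
    ∫⁻ t in Ioo a 1, ENNReal.ofReal ((1 - t ^ q) ^ (1 / q - 1)) =
      ∫⁻ t in Ioo 0 a, ENNReal.ofReal ((1 - t ^ q) ^ (1 / q - 1)) := by
  have hq0 : 0 < q := by linarith
  have hfa : (1 - a ^ q) ^ (1 / q) = a := by
    have h := one_sub_rpow_rpow_involutive hq0 ha
    have : (1 : ℝ) - a ^ q = a ^ q := by rw [haq]; norm_num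
    rw [this, ← Real.rpow_mul ha.1.le, mul_one_div_cancel hq0.ne', Real.rpow_one]
  have hanti : ∀ s t : ℝ, s ∈ Ioo (0 : ℝ) 1 → t ∈ Ioo (0 : ℝ) 1 → s < t →
      (1 - t ^ q) ^ (1 / q) < (1 - s ^ q) ^ (1 / q) := fun s t hs ht hst =>
    Real.rpow_lt_rpow (one_sub_rpow_pos hq0 ⟨by linarith [ht.1], ht.2⟩).le
      (by linarith [Real.rpow_lt_rpow hs.1.le hst hq0]) (by positivity)
  have himg : (fun t : ℝ => (1 - t ^ q) ^ (1 / q)) '' Ioo 0 a = Ioo a 1 := by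
    ext y
    constructor
    · rintro ⟨t, ht, rfl⟩
      have ht' : t ∈ Ioo (0 : ℝ) 1 := ⟨ht.1, ht.2.trans ha.2⟩
      refine ⟨?_, (one_sub_rpow_rpow_mem_Ioo hq0 ht').2⟩
      have := hanti t a ht' ha ht.2
      rwa [hfa] at this
    · intro hy
      have hy' : y ∈ Ioo (0 : ℝ) 1 := ⟨ha.1.trans hy.1, hy.2⟩
      refine ⟨_, ⟨(one_sub_rpow_rpow_mem_Ioo hq0 hy').1, ?_⟩, one_sub_rpow_rpow_involutive hq0 hy'⟩
      have := hanti a y ha hy' hy.1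
      rwa [hfa] at this
  have hinj : InjOn (fun t : ℝ => (1 - t ^ q) ^ (1 / q)) (Ioo 0 a) := by
    intro s hs t ht hst
    dsimp only at hst
    rw [← one_sub_rpow_rpow_involutive hq0 (t := s) ⟨hs.1, hs.2.trans ha.2⟩, hst,
      one_sub_rpow_rpow_involutive hq0 (t := t) ⟨ht.1, ht.2.trans ha.2⟩]
  rw [← himg, lintegral_image_eq_lintegral_abs_deriv_mul measurableSet_Ioo
    (fun t ht => (hasDerivAt_one_sub_rpow_rpow hq
      ⟨ht.1.le, ht.2.trans ha.2⟩).hasDerivWithinAt) hinj]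
  refine setLIntegral_congr_fun measurableSet_Ioo fun t ht => ?_
  have hpos := one_sub_rpow_pos hq0 (t := t) ⟨by linarith [ht.1], ht.2.trans ha.2⟩
  rw [← ENNReal.ofReal_mul (abs_nonneg _), abs_neg, ← Real.rpow_mul hpos.le (1 / q) q,
    one_div_mul_cancel hq0.ne', Real.rpow_one, sub_sub_cancel, ← Real.rpow_mul ht.1.le,
    abs_of_pos (mul_pos (Real.rpow_pos_of_pos ht.1 _) (Real.rpow_pos_of_pos hpos _)),
    mul_right_comm, ← Real.rpow_add ht.1]
  have : q - 1 + q * (1 / q - 1) = 0 := by field_simp; ring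
  rw [this, Real.rpow_zero, one_mul]

theorem genPi_div_four_le {q a : ℝ} (hq : 1 < q) (ha : a ∈ Ioo (0 : ℝ) 1)
    (haq : a ^ q = 1 / 2) :
    genPi (q / (q - 1)) q / 4 ≤ ENNReal.ofReal (genF (q / (q - 1)) q a) := by
  rw [← lintegral_genF_integrand _ (by linarith) ⟨ha.1.le, ha.2⟩, genPi]
  simp only [neg_one_div_conjExponent hq]
  set I := ∫⁻ t in Ioc 0 a, ENNReal.ofReal ((1 - t ^ q) ^ (1 / q - 1)) with hI
  have h1 : ∫⁻ t in Ioo 0 1, ENNReal.ofReal ((1 - t ^ q) ^ (1 / q - 1)) ≤ I + I := by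
    rw [← Ioc_union_Ioo_eq_Ioo ha.1.le ha.2]
    refine (lintegral_union_le _ _ _).trans ?_
    rw [lintegral_upper_eq_lintegral_lower hq ha haq]
    gcongr
    exact lintegral_mono_set Ioo_subset_Ioc_self
  refine ENNReal.div_le_of_le_mul ?_
  calc _ ≤ 2 * (I + I) := by gcongr
    _ = I * 4 := by ring

theorem two_rpow_two_div_rpow {q : ℝ} (hq : 0 < q) : ((2 : ℝ) ^ (2 / q)) ^ q = 4 := by
  rw [← Real.rpow_mul (by norm_num), div_mul_cancel₀ _ hq.ne']
  norm_num

theorem doubling_rpow {q t : ℝ} (hq : 0 < q) (ht : t ∈ Ico (0 : ℝ) 1) :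
    ((2 : ℝ) ^ (2 / q) * (t * (1 - t ^ q) ^ (1 / q))) ^ q = 4 * (t ^ q * (1 - t ^ q)) := by
  have hpos := one_sub_rpow_pos hq (t := t) ⟨by linarith [ht.1], ht.2⟩
  have hr := Real.rpow_nonneg hpos.le (1 / q)
  rw [Real.mul_rpow (by positivity) (mul_nonneg ht.1 hr), Real.mul_rpow ht.1 hr,
    two_rpow_two_div_rpow hq, ← Real.rpow_mul hpos.le, one_div_mul_cancel hq.ne', Real.rpow_one]

theorem doubling_mem_Ico {q t : ℝ} (hq : 0 < q) (ht : t ∈ Ico (0 : ℝ) 1) (htq : t ^ q < 1 / 2) :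
    (2 : ℝ) ^ (2 / q) * (t * (1 - t ^ q) ^ (1 / q)) ∈ Ico (0 : ℝ) 1 := by
  have hpos := one_sub_rpow_pos hq (t := t) ⟨by linarith [ht.1], ht.2⟩
  have h0 : 0 ≤ (2 : ℝ) ^ (2 / q) * (t * (1 - t ^ q) ^ (1 / q)) :=
    mul_nonneg (by positivity) (mul_nonneg ht.1 (Real.rpow_nonneg hpos.le _))
  refine ⟨h0, ?_⟩
  rw [← Real.rpow_lt_rpow_iff h0 zero_le_one hq, doubling_rpow hq ht, Real.one_rpow]
  nlinarith [sq_pos_of_pos (by linarith : 0 < 1 - 2 * t ^ q)]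

theorem hasDerivAt_doubling {q t : ℝ} (hq : 1 < q) (ht : t ∈ Ico (0 : ℝ) 1) :
    HasDerivAt (fun t : ℝ => (2 : ℝ) ^ (2 / q) * (t * (1 - t ^ q) ^ (1 / q)))
      ((2 : ℝ) ^ (2 / q) * ((1 - t ^ q) ^ (1 / q - 1) * (1 - 2 * t ^ q))) t := by
  have hpos := one_sub_rpow_pos (by linarith : 0 < q) (t := t) ⟨by linarith [ht.1], ht.2⟩
  have h := ((hasDerivAt_id t).mul (hasDerivAt_one_sub_rpow_rpow hq ht)).const_mul
    ((2 : ℝ) ^ (2 / q))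
  refine h.congr_deriv ?_
  have h1 : (1 - t ^ q) ^ (1 / q) = (1 - t ^ q) ^ (1 / q - 1) * (1 - t ^ q) := by
    rw [← Real.rpow_add_one hpos.ne', sub_add_cancel]
  have h2 : t ^ q = t * t ^ (q - 1) := by
    rw [mul_comm, ← Real.rpow_add_one' ht.1 (by linarith), sub_add_cancel]
  simp only [id, one_mul]
  rw [h1]
  generalize (1 - t ^ q) ^ (1 / q - 1) = v
  rw [h2]
  ring

theorem genF_doubling {q s : ℝ} (hq : 1 < q) (hs : s ∈ Ico (0 : ℝ) 1) (hsq : s ^ q < 1 / 2) :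
    genF 2 q ((2 : ℝ) ^ (2 / q) * (s * (1 - s ^ q) ^ (1 / q))) =
      (2 : ℝ) ^ (2 / q) * genF (q / (q - 1)) q s := by
  have hq0 : 0 < q := by linarith
  have hder : ∀ t ∈ Icc 0 s, HasDerivAt (fun t : ℝ =>
      genF 2 q ((2 : ℝ) ^ (2 / q) * (t * (1 - t ^ q) ^ (1 / q))) -
        (2 : ℝ) ^ (2 / q) * genF (q / (q - 1)) q t) 0 t := by
    intro t ht
    have ht1 : t ∈ Ico (0 : ℝ) 1 := ⟨ht.1, ht.2.trans_lt hs.2⟩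
    have htq : t ^ q < 1 / 2 := (Real.rpow_le_rpow ht.1 ht.2 hq0.le).trans_lt hsq
    have hm := doubling_mem_Ico hq0 ht1 htq
    have h1 := (hasStrictDerivAt_genF 2 hq0 (y := (2 : ℝ) ^ (2 / q) * (t * (1 - t ^ q) ^ (1 / q)))
      ⟨by linarith [hm.1], hm.2⟩).hasDerivAt.comp t (hasDerivAt_doubling hq ht1)
    have h2 := (hasStrictDerivAt_genF (q / (q - 1)) hq0 (y := t)
      ⟨by linarith [ht.1], ht1.2⟩).hasDerivAt.const_mul ((2 : ℝ) ^ (2 / q))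
    refine (h1.sub h2).congr_deriv ?_
    have hpos : 0 < 1 - 2 * t ^ q := by linarith
    have h3 : (1 - 4 * (t ^ q * (1 - t ^ q))) ^ (-(1 / 2) : ℝ) = (1 - 2 * t ^ q)⁻¹ := by
      have : 1 - 4 * (t ^ q * (1 - t ^ q)) = (1 - 2 * t ^ q) ^ 2 := by ring
      rw [this, Real.rpow_neg (by positivity), ← Real.sqrt_eq_rpow, Real.sqrt_sq hpos.le]
    rw [doubling_rpow hq0 ht1, neg_one_div_conjExponent hq, h3]
    field_simp
    ring
  have h := constant_of_has_deriv_right_zero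
    (fun t ht => (hder t ht).continuousAt.continuousWithinAt)
    (fun t ht => (hder t (Ico_subset_Icc_self ht)).hasDerivWithinAt) s ⟨hs.1, le_rfl⟩
  simp only [zero_mul, mul_zero, genF_zero, sub_zero] at h
  linarith

/-- for `1 < q < ∞`, `q* = q/(q-1)` and `x ∈ [0, π_{q*,q}/4)`,
`cos_{2,q}(2^(2/q) x) = (cos_{q*,q} x)^(q*) - (sin_{q*,q} x)^q`. -/
theorem multiple_angle_cos (q qs : ℝ) (hq : 1 < q) (hqs : qs = q / (q - 1))
    (x : ℝ) (hx0 : 0 ≤ x) (hx : ENNReal.ofReal x < genPi qs q / 4) :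
    gcos 2 q ((2:ℝ) ^ (2 / q) * x) =
      gcos qs q x ^ qs - gsin qs q x ^ q := by
  subst hqs
  have hq0 : 0 < q := by linarith
  obtain ⟨a, ha, haq⟩ : ∃ a ∈ Ioo (0 : ℝ) 1, a ^ q = 1 / 2 := by
    refine ⟨(1 / 2) ^ (1 / q), ⟨by positivity,
      Real.rpow_lt_one (by norm_num) (by norm_num) (by positivity)⟩, ?_⟩
    rw [← Real.rpow_mul (by norm_num), one_div_mul_cancel hq0.ne', Real.rpow_one]
  have hxa : x < genF (q / (q - 1)) q a :=
    (ENNReal.ofReal_lt_ofReal_iff_of_nonneg hx0).1 (hx.trans_le (genPi_div_four_le hq ha haq))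
  have hcont : ContinuousOn (genF (q / (q - 1)) q) (Icc 0 a) := fun t ht =>
    (hasStrictDerivAt_genF _ hq0 ⟨by linarith [ht.1],
      ht.2.trans_lt ha.2⟩).hasDerivAt.continuousAt.continuousWithinAt
  obtain ⟨s, hsa, rfl⟩ := intermediate_value_Ico ha.1.le hcont
    ⟨by rwa [genF_zero], hxa⟩
  have hs : s ∈ Ico (0 : ℝ) 1 := ⟨hsa.1, hsa.2.trans ha.2⟩
  have hsq : s ^ q < 1 / 2 := haq ▸ Real.rpow_lt_rpow hsa.1 hsa.2 hq0
  have hpos := one_sub_rpow_pos hq0 (t := s) ⟨by linarith [hs.1], hs.2⟩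
  have hq1 : q / (q - 1) ≠ 0 := (div_pos hq0 (by linarith)).ne'
  rw [← genF_doubling hq hs hsq, gcos_genF 2 hq0 (doubling_mem_Ico hq0 hs hsq),
    gcos_genF _ hq0 hs, gsin_genF _ hq0 hs, doubling_rpow hq0 hs, ← Real.rpow_mul hpos.le,
    one_div_mul_cancel hq1, Real.rpow_one, ← Real.sqrt_eq_rpow,
    show 1 - 4 * (s ^ q * (1 - s ^ q)) = (1 - 2 * s ^ q) ^ 2 by ring,
    Real.sqrt_sq (by linarith)]
  ring
end

section
/- Let 1 < q < ∞. Then for all x ∈ [0, π_{q*,q}/4), cosh_{2q/(q+2),q}(2^{2/q} x) = ((1 + (sinh_{q/2,q}(x))^q) / (1 − (sinh_{q/2,q}(x))^q))^{2/q + 1}. -/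
open MeasureTheory Set
open scoped ENNReal

open Filter Topology

section GenG

variable {p q : ℝ}

/-- The integrand of `genG p q`, extended evenly to the real line, is continuous. -/
lemma continuous_one_add_abs_rpow (hq : 0 < q) (a : ℝ) :
    Continuous fun t : ℝ => (1 + |t| ^ q) ^ a :=
  (continuous_const.add (continuous_abs.rpow_const fun _ => Or.inr hq.le)).rpow_const
    fun t => Or.inl (by positivity : (0:ℝ) < 1 + |t| ^ q).ne'

lemma genG_eq_integral_abs {y : ℝ} (hy : 0 ≤ y) :
    genG p q y = ∫ t in (0:ℝ)..y, (1 + |t| ^ q) ^ (-(1 / p)) := by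
  refine intervalIntegral.integral_congr fun t ht => ?_
  rw [uIcc_of_le hy] at ht
  simp only [abs_of_nonneg ht.1]

lemma hasStrictDerivAt_integral_abs (hq : 0 < q) (p y : ℝ) :
    HasStrictDerivAt (fun y => ∫ t in (0:ℝ)..y, (1 + |t| ^ q) ^ (-(1 / p)))
      ((1 + |y| ^ q) ^ (-(1 / p))) y :=
  (continuous_one_add_abs_rpow hq _).integral_hasStrictDerivAt 0 y

lemma strictMono_integral_abs (hq : 0 < q) (p : ℝ) :
    StrictMono fun y => ∫ t in (0:ℝ)..y, (1 + |t| ^ q) ^ (-(1 / p)) :=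
  strictMono_of_deriv_pos fun y => by
    rw [(hasStrictDerivAt_integral_abs hq p y).hasDerivAt.deriv]
    positivity

lemma strictMonoOn_genG (hq : 0 < q) (p : ℝ) : StrictMonoOn (genG p q) (Ici 0) := by
  intro a ha b hb hab
  rw [genG_eq_integral_abs ha, genG_eq_integral_abs hb]
  exact strictMono_integral_abs hq p hab

lemma continuousOn_genG (hq : 0 < q) (p : ℝ) : ContinuousOn (genG p q) (Ici 0) := by
  refine ContinuousOn.congr (f := fun y => ∫ t in (0:ℝ)..y, (1 + |t| ^ q) ^ (-(1 / p))) ?_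
    fun y hy => genG_eq_integral_abs hy
  exact fun y _ => (hasStrictDerivAt_integral_abs hq p y).hasDerivAt.continuousAt.continuousWithinAt

lemma genG_zero (p q : ℝ) : genG p q 0 = 0 := intervalIntegral.integral_same

lemma gsinh_genG (hq : 0 < q) (p : ℝ) {s : ℝ} (hs : 0 ≤ s) : gsinh p q (genG p q s) = s :=
  (strictMonoOn_genG hq p).injOn.leftInvOn_invFunOn hs

lemma genG_nonneg (hq : 0 < q) (p : ℝ) {s : ℝ} (hs : 0 ≤ s) : 0 ≤ genG p q s := by
  simpa only [genG_zero] using (strictMonoOn_genG hq p).monotoneOn self_mem_Ici hs hs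

lemma gcosh_genG (hq : 0 < q) (p : ℝ) {s : ℝ} (hs : 0 ≤ s) :
    gcosh p q (genG p q s) = (1 + s ^ q) ^ (1 / p) := by
  have hd := hasStrictDerivAt_integral_abs hq p s
  have hne : (1 + |s| ^ q) ^ (-(1 / p)) ≠ 0 := by positivity
  have hinv := (hd.to_localInverse hne).hasDerivAt
  have hright := hd.eventually_right_inverse hne
  set L := hd.localInverse _ _ _ hne
  rw [← genG_eq_integral_abs hs] at hinv hright
  have heq : gsinh p q =ᶠ[𝓝[Ici 0] (genG p q s)] L := by
    filter_upwards [nhdsWithin_le_nhds hright, self_mem_nhdsWithin] with y hy hy0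
    have hL : 0 ≤ L y := by
      rw [← (strictMono_integral_abs hq p).le_iff_le, hy, intervalIntegral.integral_same]
      exact hy0
    rw [← genG_eq_integral_abs hL] at hy
    rw [← gsinh_genG hq p hL, hy]
  have hmem : genG p q s ∈ Ici (0:ℝ) := genG_nonneg hq p hs
  have hder := hinv.hasDerivWithinAt.congr_of_eventuallyEq_of_mem heq hmem
  rw [gcosh, hder.derivWithin (uniqueDiffOn_Ici 0 _ hmem), abs_of_nonneg hs,
    Real.rpow_neg (by positivity), inv_inv]

end GenG

section MultipleAngle

variable {q : ℝ}

/-- The substitution `t ↦ 2^(2/q) t / (1 - t^q)^(2/q)`, which sends `sinh_{q/2,q} x` to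
`sinh_{2q/(q+2),q} (2^(2/q) x)`. -/
noncomputable def multipleAngle (q t : ℝ) : ℝ := 2 ^ (2 / q) * (t * (1 - t ^ q) ^ (-(2 / q)))

lemma multipleAngle_nonneg {t : ℝ} (ht : 0 ≤ t) (ht1 : t ^ q < 1) :
    0 ≤ multipleAngle q t := by
  have : 0 < 1 - t ^ q := by linarith
  unfold multipleAngle
  positivity

lemma one_add_multipleAngle_rpow (hq : 0 < q) {t : ℝ} (ht : 0 ≤ t) (ht1 : t ^ q < 1) :
    1 + multipleAngle q t ^ q = ((1 + t ^ q) / (1 - t ^ q)) ^ (2:ℝ) := by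
  have h1 : 0 < 1 - t ^ q := by linarith
  have e : -(2 / q) * q = -2 := by field_simp
  have e' : 2 / q * q = 2 := by field_simp
  rw [multipleAngle, Real.mul_rpow (by positivity) (by positivity),
    Real.mul_rpow ht (by positivity), ← Real.rpow_mul h1.le, ← Real.rpow_mul zero_le_two, e, e',
    Real.rpow_neg h1.le, Real.rpow_two, Real.rpow_two, Real.rpow_two]
  field_simp
  ring

lemma one_add_multipleAngle_rpow_rpow (hq : 0 < q) {t : ℝ} (ht : 0 ≤ t) (ht1 : t ^ q < 1) :
    (1 + multipleAngle q t ^ q) ^ (1 / (2 * q / (q + 2))) =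
      ((1 + t ^ q) / (1 - t ^ q)) ^ (2 / q + 1) := by
  have h1 : 0 < 1 - t ^ q := by linarith
  rw [one_add_multipleAngle_rpow hq ht ht1, ← Real.rpow_mul (by positivity)]
  congr 1
  field_simp
  ring

lemma mul_rpow_sub_one {t : ℝ} (ht : 0 ≤ t) (hq : q ≠ 0) : t * t ^ (q - 1) = t ^ q := by
  conv_lhs => rw [← Real.rpow_one_add' ht (by simpa using hq)]
  congr 1
  ring

lemma hasDerivAt_mul_one_sub_rpow_rpow (hq : 1 ≤ q) {t : ℝ} (ht : 0 ≤ t) (ht1 : t ^ q < 1)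
    (a : ℝ) :
    HasDerivAt (fun t => t * (1 - t ^ q) ^ (-a))
      ((1 + (a * q - 1) * t ^ q) * (1 - t ^ q) ^ (-a - 1)) t := by
  have h1 : 0 < 1 - t ^ q := by linarith
  have h := (hasDerivAt_id t).mul (((Real.hasDerivAt_rpow_const (x := t) (p := q)
    (Or.inr hq)).const_sub 1).rpow_const (p := -a) (Or.inl h1.ne'))
  refine h.congr_deriv ?_
  have e : (1 - t ^ q) ^ (-a) = (1 - t ^ q) * (1 - t ^ q) ^ (-a - 1) := by
    rw [mul_comm, ← Real.rpow_add_one h1.ne', sub_add_cancel]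
  have e' := mul_rpow_sub_one ht (by linarith : q ≠ 0)
  simp only [id, e]
  linear_combination (a * q * (1 - t ^ q) ^ (-a - 1)) * e'

lemma hasDerivAt_multipleAngle (hq : 1 ≤ q) {t : ℝ} (ht : 0 ≤ t) (ht1 : t ^ q < 1) :
    HasDerivAt (multipleAngle q)
      (2 ^ (2 / q) * ((1 + t ^ q) * (1 - t ^ q) ^ (-(2 / q) - 1))) t := by
  refine ((hasDerivAt_mul_one_sub_rpow_rpow hq ht ht1 (2 / q)).const_mul _).congr_deriv ?_
  have e : 2 / q * q = 2 := by field_simp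
  rw [e]
  ring

lemma genG_multipleAngle (hq : 1 < q) {s : ℝ} (hs : 0 ≤ s) (hs1 : s < 1) :
    genG (2 * q / (q + 2)) q (multipleAngle q s) = 2 ^ (2 / q) * genG (q / 2) q s := by
  have hq0 : 0 < q := by linarith
  have hlt : ∀ t ∈ uIcc 0 s, 0 ≤ t ∧ t ^ q < 1 := fun t ht => by
    rw [uIcc_of_le hs] at ht
    exact ⟨ht.1, Real.rpow_lt_one ht.1 (ht.2.trans_lt hs1) hq0⟩
  have hpow : Continuous fun t : ℝ => t ^ q :=
    continuous_id.rpow_const fun _ => Or.inr hq0.le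
  have hsub := intervalIntegral.integral_comp_mul_deriv
    (g := fun t : ℝ => (1 + |t| ^ q) ^ (-(1 / (2 * q / (q + 2)))))
    (fun t ht => hasDerivAt_multipleAngle hq.le (hlt t ht).1 (hlt t ht).2)
    (continuousOn_const.mul ((continuous_const.add hpow).continuousOn.mul
      ((continuous_const.sub hpow).continuousOn.rpow_const
        fun t ht => Or.inl (sub_pos.2 (hlt t ht).2).ne')))
    (continuous_one_add_abs_rpow hq0 _)
  have h0 : multipleAngle q 0 = 0 := by simp [multipleAngle]
  rw [genG_eq_integral_abs (multipleAngle_nonneg hs (hlt s right_mem_uIcc).2)]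
  rw [h0] at hsub
  rw [← hsub, genG, ← intervalIntegral.integral_const_mul]
  refine intervalIntegral.integral_congr fun t ht => ?_
  obtain ⟨ht0, ht1⟩ := hlt t ht
  have h1 : 0 < 1 - t ^ q := by linarith
  have h2 : 0 < 1 + t ^ q := by positivity
  have hu := multipleAngle_nonneg ht0 ht1
  have e : -(1 / (q / 2)) = 1 + -(2 / q + 1) := by field_simp; ring
  simp only [Function.comp, abs_of_nonneg hu]
  rw [Real.rpow_neg (by positivity), one_add_multipleAngle_rpow_rpow hq0 ht0 ht1,
    ← Real.rpow_neg (by positivity), Real.div_rpow h2.le h1.le, e, Real.rpow_add h2, Real.rpow_one,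
    ← neg_add', Real.rpow_neg h1.le]
  have : (1 - t ^ q) ^ (2 / q + 1) ≠ 0 := by positivity
  field_simp

end MultipleAngle

section GenPi

variable {q : ℝ}

lemma lintegral_genF_integrand_le (hq : 1 < q) :
    ∫⁻ t in Ioo (0:ℝ) 1, ENNReal.ofReal ((1 - t ^ q) ^ (-(1 / (q / (q - 1))))) ≤
      ∫⁻ t in Ioi (0:ℝ), ENNReal.ofReal ((1 + t ^ q) ^ (-(1 / (q / 2)))) := by
  have hq0 : 0 < q := by linarith
  have hlt : ∀ t ∈ Ioo (0:ℝ) 1, 0 < t ∧ t ^ q < 1 := fun t ht =>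
    ⟨ht.1, Real.rpow_lt_one ht.1.le ht.2 hq0⟩
  have hmono : StrictMonoOn (fun t : ℝ => t * (1 - t ^ q) ^ (-(1 / q))) (Ioo 0 1) := by
    intro a ha b hb hab
    have h1 : 0 < 1 - a ^ q := by linarith [(hlt a ha).2]
    have h2 : 0 < 1 - b ^ q := by linarith [(hlt b hb).2]
    have h3 : a ^ q ≤ b ^ q := Real.rpow_le_rpow ha.1.le hab.le hq0.le
    have h4 : (1 - a ^ q) ^ (-(1 / q)) ≤ (1 - b ^ q) ^ (-(1 / q)) :=
      Real.rpow_le_rpow_of_nonpos h2 (by linarith) (by simpa using hq0.le)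
    exact mul_lt_mul hab h4 (by positivity) hb.1.le
  have himage : (fun t : ℝ => t * (1 - t ^ q) ^ (-(1 / q))) '' Ioo 0 1 ⊆ Ioi 0 := by
    rintro _ ⟨t, ht, rfl⟩
    have h1 : 0 < 1 - t ^ q := by linarith [(hlt t ht).2]
    exact mul_pos ht.1 (by positivity)
  refine le_trans (le_of_eq ?_) (lintegral_mono_set himage)
  rw [lintegral_image_eq_lintegral_abs_deriv_mul measurableSet_Ioo (fun t ht =>
    (hasDerivAt_mul_one_sub_rpow_rpow hq.le ht.1.le (hlt t ht).2 (1 / q)).hasDerivWithinAt)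
    hmono.injOn]
  refine setLIntegral_congr_fun measurableSet_Ioo fun t ht => ?_
  have h1 : 0 < 1 - t ^ q := by linarith [(hlt t ht).2]
  have ht0 := ht.1
  have e : 1 / q * q = 1 := by field_simp
  have e' : -(1 / q) * q = -1 := by field_simp
  have e'' : 1 + t ^ q * (1 - t ^ q)⁻¹ = (1 - t ^ q)⁻¹ := by field_simp; ring
  rw [← ENNReal.ofReal_mul (abs_nonneg _), e, sub_self, zero_mul, add_zero, one_mul,
    abs_of_nonneg (by positivity), Real.mul_rpow ht0.le (by positivity), ← Real.rpow_mul h1.le, e',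
    Real.rpow_neg_one, e'', ← Real.rpow_neg_eq_inv_rpow, ← Real.rpow_add h1]
  congr 2
  field_simp
  ring

lemma lintegral_Ioi_one_le (hq : 0 < q) :
    ∫⁻ t in Ioi (1:ℝ), ENNReal.ofReal ((1 + t ^ q) ^ (-(1 / (q / 2)))) ≤
      ∫⁻ t in Ioo (0:ℝ) 1, ENNReal.ofReal ((1 + t ^ q) ^ (-(1 / (q / 2)))) := by
  have himage : (fun t : ℝ => t⁻¹) '' Ioi 1 ⊆ Ioo 0 1 := by
    rintro _ ⟨t, ht, rfl⟩
    exact ⟨inv_pos.2 (zero_lt_one.trans ht), inv_lt_one_of_one_lt₀ ht⟩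
  refine le_trans (le_of_eq ?_) (lintegral_mono_set himage)
  rw [lintegral_image_eq_lintegral_abs_deriv_mul measurableSet_Ioi (fun t ht =>
    (hasDerivAt_inv (zero_lt_one.trans ht).ne').hasDerivWithinAt) inv_injective.injOn]
  refine setLIntegral_congr_fun measurableSet_Ioi fun t ht => ?_
  have ht0 : 0 < t := zero_lt_one.trans ht
  have e : 1 + t⁻¹ ^ q = t ^ (-q) * (1 + t ^ q) := by
    rw [← Real.rpow_neg_eq_inv_rpow, mul_add, ← Real.rpow_add ht0]
    simp [add_comm]
  have e' : -q * -(1 / (q / 2)) = 2 := by field_simp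
  rw [← ENNReal.ofReal_mul (abs_nonneg _), abs_neg, abs_of_pos (by positivity), e,
    Real.mul_rpow (by positivity) (by positivity), ← Real.rpow_mul ht0.le, e', Real.rpow_two,
    inv_mul_cancel_left₀ (by positivity)]

lemma lintegral_Ioo_eq_genG {p y : ℝ} (hq : 0 < q) (hy : 0 ≤ y) :
    ∫⁻ t in Ioo 0 y, ENNReal.ofReal ((1 + t ^ q) ^ (-(1 / p))) = ENNReal.ofReal (genG p q y) := by
  have hint : IntegrableOn (fun t : ℝ => (1 + |t| ^ q) ^ (-(1 / p))) (Ioc 0 y) :=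
    ((continuous_one_add_abs_rpow hq _).intervalIntegrable 0 y).1
  rw [genG_eq_integral_abs hy, intervalIntegral.integral_of_le hy,
    ofReal_integral_eq_lintegral_ofReal hint (ae_of_all _ fun t => by positivity),
    setLIntegral_congr Ioo_ae_eq_Ioc]
  refine setLIntegral_congr_fun measurableSet_Ioc fun t ht => ?_
  simp only [abs_of_pos ht.1]

lemma genPi_conjExponent_le (hq : 1 < q) :
    genPi (q / (q - 1)) q ≤ 4 * ENNReal.ofReal (genG (q / 2) q 1) := by
  have hq0 : 0 < q := by linarith
  have hsplit := lintegral_union_le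
    (fun t : ℝ => ENNReal.ofReal ((1 + t ^ q) ^ (-(1 / (q / 2))))) (Ioc 0 1) (Ioi 1)
    (μ := volume)
  rw [Ioc_union_Ioi_eq_Ioi zero_le_one, ← setLIntegral_congr Ioo_ae_eq_Ioc] at hsplit
  have h := (lintegral_genF_integrand_le hq).trans
    (hsplit.trans (add_le_add_right (lintegral_Ioi_one_le hq0) _))
  rw [lintegral_Ioo_eq_genG hq0 zero_le_one, ← two_mul] at h
  calc genPi (q / (q - 1)) q ≤ 2 * (2 * ENNReal.ofReal (genG (q / 2) q 1)) :=
        mul_le_mul_right h 2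
    _ = 4 * ENNReal.ofReal (genG (q / 2) q 1) := by rw [← mul_assoc]; norm_num

lemma exists_genG_eq (hq : 1 < q) {x : ℝ} (hx0 : 0 ≤ x)
    (hx : ENNReal.ofReal x < genPi (q / (q - 1)) q / 4) :
    ∃ s, 0 ≤ s ∧ s < 1 ∧ genG (q / 2) q s = x := by
  have hq0 : 0 < q := by linarith
  have hlt : x < genG (q / 2) q 1 := by
    refine (ENNReal.ofReal_lt_ofReal_iff_of_nonneg hx0).1 (hx.trans_le ?_)
    exact ENNReal.div_le_of_le_mul' (genPi_conjExponent_le hq)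
  obtain ⟨s, hs, hsx⟩ := intermediate_value_Ico zero_le_one
    ((continuousOn_genG hq0 (q / 2)).mono Icc_subset_Ici_self)
    (show x ∈ Ico _ _ from ⟨by rwa [genG_zero], hlt⟩)
  exact ⟨s, hs.1, hs.2, hsx⟩

end GenPi

/-- for `1 < q < ∞` and `x ∈ [0, π_{q*,q}/4)` (with `q* = q/(q-1)`),
`cosh_{2q/(q+2),q}(2^(2/q) x) = ((1 + (sinh_{q/2,q} x)^q)/(1 - (sinh_{q/2,q} x)^q))^(2/q+1)`. -/
theorem multiple_angle_cosh (q : ℝ) (hq : 1 < q)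
    (x : ℝ) (hx0 : 0 ≤ x) (hx : ENNReal.ofReal x < genPi (q / (q - 1)) q / 4) :
    gcosh (2 * q / (q + 2)) q ((2:ℝ) ^ (2 / q) * x) =
      ((1 + gsinh (q / 2) q x ^ q) / (1 - gsinh (q / 2) q x ^ q)) ^ (2 / q + 1) := by
  have hq0 : 0 < q := by linarith
  obtain ⟨s, hs0, hs1, rfl⟩ := exists_genG_eq hq hx0 hx
  have hsq : s ^ q < 1 := Real.rpow_lt_one hs0 hs1 hq0
  rw [← genG_multipleAngle hq hs0 hs1, gcosh_genG hq0 _ (multipleAngle_nonneg hs0 hsq),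
    gsinh_genG hq0 _ hs0, one_add_multipleAngle_rpow_rpow hq0 hs0 hsq]
end
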